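/- Let n ≥ 2 and r be positive integers and let p be an odd prime. Then Σ_{b=1}^{⌊n/2⌋} α_{n,b} · binom(n, b) · σ_n^{(b)}(2p^r, p) = (1/2)·R_n^{(1)}(p^r) − R_n^{(2)}(p^r), where α_{n,b} = 1 except that α_{n,n/2} = 1/2 when n is even. Moreover, if in addition p > n+1 and r ≥ 2, then this quantity is ≡ −(3/2)·S_n^{(1)}(p^2)·p^{r−2} (mod p^r). -/

import Mathlib

open Finset

attribute [local instance] Classical.propDecidable

/-- `x ≡ y (mod p^s)` for rational numbers `x, y`: the `p`-adic valuation of `x - y`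
is at least `s` (where the valuation of `0` is regarded as `+∞`). -/
def padicCong (p s : ℕ) (x y : ℚ) : Prop :=
  x = y ∨ (s : ℤ) ≤ padicValRat p (x - y)

/-- `Z_n(N,p)`: the sum of `1/(l₁⋯lₙ)` over all ordered `n`-tuples `(l₁,…,lₙ)` of
positive integers not divisible by `p` with `l₁+⋯+lₙ = N`. -/
noncomputable def Zsum (p n N : ℕ) : ℚ :=
  ∑ l ∈ (Finset.Nat.antidiagonalTuple n N).filter
      (fun l => ∀ i, 0 < l i ∧ ¬ p ∣ l i),
    ∏ i, (l i : ℚ)⁻¹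

/-- `S_n^{(m)}(p^r)`: the sum of `1/(l₁⋯lₙ)` over all ordered `n`-tuples `(l₁,…,lₙ)` of
positive integers not divisible by `p`, each `< p^r`, with `l₁+⋯+lₙ = m·p^r`. -/
noncomputable def Ssum (p n m r : ℕ) : ℚ :=
  ∑ l ∈ (Finset.Nat.antidiagonalTuple n (m * p ^ r)).filter
      (fun l => ∀ i, (0 < l i ∧ ¬ p ∣ l i) ∧ l i < p ^ r),
    ∏ i, (l i : ℚ)⁻¹

/-- `σ_n^{(b)}(N,p)`: the sum of `(-1)^(l₁+⋯+l_b)/(l₁⋯lₙ)` over all ordered `n`-tuples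
`(l₁,…,lₙ)` of positive integers not divisible by `p` with `l₁+⋯+lₙ = N`. -/
noncomputable def sigmaSum (p n b N : ℕ) : ℚ :=
  ∑ l ∈ (Finset.Nat.antidiagonalTuple n N).filter
      (fun l => ∀ i, 0 < l i ∧ ¬ p ∣ l i),
    (-1 : ℚ) ^ (∑ i ∈ univ.filter (fun i : Fin n => (i : ℕ) < b), l i) *
      ∏ i, (l i : ℚ)⁻¹

/-- The value of a finite tuple at position `j`, extended by `0`. -/
noncomputable def seqAt {k : ℕ} (u : Fin k → ℕ) (j : ℕ) : ℕ :=
  if h : j < k then u ⟨j, h⟩ else 0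

/-- The chain `i₁, i₂, …, i_d, l₁+⋯+l_a` (indexed from `0`): position `j < d` gives
`i_{j+1}` and position `d` (or beyond) gives `l₁+⋯+l_a`. -/
noncomputable def Fchain {d a : ℕ} (i : Fin d → ℕ) (l : Fin a → ℕ) : ℕ → ℕ :=
  fun j => if h : j < d then i ⟨j, h⟩ else ∑ k, l k

/-- The summation conditions for `F_a^{(b)}(s,N,p)`:
`N > i₁ > ⋯ > i_d > l₁+⋯+l_a`, each `l_k ∈ 𝒫_p`, and
`i₁, i₁-i₂, …, i_{d-1}-i_d, i_d-(l₁+⋯+l_a) ∈ 𝒫_p`.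
(When `d = 0` this reduces to `l₁+⋯+l_a < N` and each `l_k ∈ 𝒫_p`.) -/
def FCond (p : ℕ) {d a : ℕ} (i : Fin d → ℕ) (l : Fin a → ℕ) (N : ℕ) : Prop :=
  (∀ k, 0 < l k ∧ ¬ p ∣ l k) ∧
  Fchain i l 0 < N ∧
  (0 < d → 0 < Fchain i l 0 ∧ ¬ p ∣ Fchain i l 0) ∧
  ∀ j < d, Fchain i l (j + 1) < Fchain i l j ∧
    0 < Fchain i l j - Fchain i l (j + 1) ∧ ¬ p ∣ (Fchain i l j - Fchain i l (j + 1))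

/-- `F_a^{(b)}(s,N,p)` where `s = (s₁,…,s_d)` is a vector of signs. -/
noncomputable def Fsum (p a b : ℕ) {d : ℕ} (s : Fin d → ℤ) (N : ℕ) : ℚ :=
  ∑ il ∈ ((Fintype.piFinset fun _ : Fin d => Finset.range N) ×ˢ
          (Fintype.piFinset fun _ : Fin a => Finset.range N)).filter
      (fun il => FCond p il.1 il.2 N),
    (∏ j, (s j : ℚ) ^ il.1 j) *
      (-1 : ℚ) ^ (∑ k ∈ univ.filter (fun k : Fin a => (k : ℕ) < b), il.2 k) /
      ((∏ j, (il.1 j : ℚ)) * ∏ k, (il.2 k : ℚ))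

/-- `A_s`: the total size of the odd-indexed blocks in the decomposition
`s = (X_{w₁}, Z_{w₂}, …, Z_{w_l})`; equivalently, the number of positions `j` such that
the number of `-1`-entries among `s₁,…,s_j` is even. -/
noncomputable def Acount {d : ℕ} (s : Fin d → ℤ) : ℕ :=
  (univ.filter fun j : Fin d =>
    Even (univ.filter (fun k : Fin d => k ≤ j ∧ s k = -1)).card).card

/-- `B_s`: the total size of the even-indexed blocks in the decomposition
`s = (X_{w₁}, Z_{w₂}, …, Z_{w_l})`; equivalently, the number of positions `j` such that
the number of `-1`-entries among `s₁,…,s_j` is odd. -/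
noncomputable def Bcount {d : ℕ} (s : Fin d → ℤ) : ℕ :=
  (univ.filter fun j : Fin d =>
    Odd (univ.filter (fun k : Fin d => k ≤ j ∧ s k = -1)).card).card

/-- `len(W_s)`: the number of blocks, namely `1` plus the number of `-1`-entries of `s`. -/
noncomputable def lenW {d : ℕ} (s : Fin d → ℤ) : ℕ :=
  1 + (univ.filter fun k : Fin d => s k = -1).card

/-- `P_s` (for given `a ≥ b`): `a - b - A_s` if `len(W_s)` is even, `b - B_s` if odd.
For `s = ∅` this gives `P_∅ = b`. -/
noncomputable def Pval (a b : ℕ) {d : ℕ} (s : Fin d → ℤ) : ℕ :=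
  if 2 ∣ lenW s then a - b - Acount s else b - Bcount s

/-- `C_{a,b}(A,B)`, defined via falling factorials `(x)_γ = x(x-1)⋯(x-γ+1)`. -/
def Cab (a b A B : ℕ) : ℚ :=
  if A = 0 ∧ B = 0 then 1
  else if A = 0 then (b.descFactorial B : ℚ)
  else if B = 0 then ((a - b).descFactorial A : ℚ)
  else ((a - b).descFactorial A : ℚ) * (b.descFactorial B : ℚ)

open PowerSeries in
/-- The power series `∑_{p ∤ l} x^l / l`. -/
noncomputable def fser (p : ℕ) : PowerSeries ℚ :=
  PowerSeries.mk fun l => if p ∣ l then 0 else (l : ℚ)⁻¹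

theorem coeff_prod_tuple {n : ℕ} (F : Fin n → PowerSeries ℚ) (N : ℕ) :
    PowerSeries.coeff N (∏ i, F i) =
      ∑ l ∈ Finset.Nat.antidiagonalTuple n N, ∏ i, PowerSeries.coeff (l i) (F i) := by
  rw [PowerSeries.coeff_prod, ← Finset.piAntidiag_univ_fin_eq_antidiagonalTuple]
  refine Finset.sum_bij' (fun l _ => (l : Fin n → ℕ)) (fun l _ => Finsupp.equivFunOnFinite.symm l)
    ?_ ?_ ?_ ?_ ?_
  · intro a ha; simpa using ha
  · intro a ha; simpa using ha
  · intro a ha; ext; simp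
  · intro a ha; rfl
  · intro a ha; rfl

theorem sigma_eq_coeff (p n b N : ℕ) (hb : b ≤ n) :
    sigmaSum p n b N =
      PowerSeries.coeff N ((PowerSeries.rescale (-1 : ℚ) (fser p)) ^ b * (fser p) ^ (n - b)) := by
  have h1 : (PowerSeries.rescale (-1 : ℚ) (fser p)) ^ b * (fser p) ^ (n - b) =
      ∏ i : Fin n, if (i : ℕ) < b then PowerSeries.rescale (-1 : ℚ) (fser p) else fser p := by
    rw [Fin.prod_univ_eq_prod_range
      (fun i => if i < b then PowerSeries.rescale (-1 : ℚ) (fser p) else fser p) n,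
      ← Finset.prod_range_mul_prod_Ico _ hb]
    congr 1
    · rw [Finset.prod_congr rfl (g := fun _ => PowerSeries.rescale (-1 : ℚ) (fser p))]
      · simp
      · intro i hi; simp [Finset.mem_range.1 hi]
    · rw [Finset.prod_congr rfl (g := fun _ => fser p)]
      · simp
      · intro i hi; simp [(Finset.mem_Ico.1 hi).1]
  rw [h1, coeff_prod_tuple, sigmaSum, Finset.sum_filter]
  refine Finset.sum_congr rfl fun l _ => ?_
  split_ifs with h
  · rw [← Finset.prod_pow_eq_pow_sum, Finset.prod_filter, ← Finset.prod_mul_distrib]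
    refine Finset.prod_congr rfl fun i _ => ?_
    split_ifs <;> simp [fser, (h i).2]
  · push Not at h
    obtain ⟨i, hi⟩ := h
    symm
    apply Finset.prod_eq_zero (Finset.mem_univ i)
    have : p ∣ l i := by
      rcases Nat.eq_zero_or_pos (l i) with h0 | h0
      · simp [h0]
      · exact hi h0
    split_ifs <;> simp [fser, this]

theorem Z_eq_sigma (p n N : ℕ) : Zsum p n N = sigmaSum p n 0 N := by
  simp [Zsum, sigmaSum]

theorem Z_eq_coeff (p n N : ℕ) : Zsum p n N = PowerSeries.coeff N ((fser p) ^ n) := by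
  rw [Z_eq_sigma, sigma_eq_coeff _ _ _ _ (Nat.zero_le _)]; simp

theorem sigma_symm (p n b N : ℕ) (hb : b ≤ n) (hN : Even N) :
    sigmaSum p n (n - b) N = sigmaSum p n b N := by
  rw [sigma_eq_coeff _ _ _ _ hb, sigma_eq_coeff _ _ _ _ (Nat.sub_le _ _), Nat.sub_sub_self hb]
  have : (PowerSeries.rescale (-1 : ℚ) (fser p)) ^ (n - b) * (fser p) ^ b =
    PowerSeries.rescale (-1 : ℚ) ((PowerSeries.rescale (-1 : ℚ) (fser p)) ^ b
      * (fser p) ^ (n - b)) := by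
    rw [map_mul, map_pow, map_pow, PowerSeries.rescale_rescale]
    simp [mul_comm]
  rw [this, PowerSeries.coeff_rescale, hN.neg_one_pow, one_mul]

theorem fser_add (p : ℕ) (hodd : Odd p) :
    PowerSeries.rescale (-1 : ℚ) (fser p) + fser p =
      PowerSeries.expand 2 two_ne_zero (fser p) := by
  ext l
  rw [PowerSeries.coeff_expand]
  simp only [fser, map_add, PowerSeries.coeff_rescale, PowerSeries.coeff_mk]
  rcases Nat.even_or_odd l with h | h
  · obtain ⟨k, rfl⟩ := h
    have h2 : p ∣ k + k ↔ p ∣ k := by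
      rw [← two_mul]
      exact (Nat.Coprime.dvd_mul_left (Nat.Coprime.symm (Nat.coprime_two_left.2 hodd)))
    have e2 : 2 ∣ k + k := ⟨k, by ring⟩
    have : (k + k) / 2 = k := by omega
    rw [Even.neg_one_pow ⟨k, rfl⟩, this]
    simp only [h2, e2, if_true]
    split_ifs with hk
    · simp
    · have : (k : ℚ) ≠ 0 := by
        rintro h; apply hk; simp only [Nat.cast_eq_zero] at h; simp [h]
      push_cast
      field_simp
  · have e2 : ¬ 2 ∣ l := by rw [← even_iff_two_dvd]; simpa using h
    simp only [h.neg_one_pow, e2, if_false]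
    split_ifs <;> simp

theorem part_one (n r : ℕ) (hn : 2 ≤ n) (p : ℕ) (hodd : Odd p) :
    (∑ b ∈ Finset.Icc 1 (n / 2),
        (if 2 ∣ n ∧ b = n / 2 then (2 : ℚ)⁻¹ else 1) * (n.choose b : ℚ) *
          sigmaSum p n b (2 * p ^ r) =
      (2 : ℚ)⁻¹ * Zsum p n (1 * p ^ r) - Zsum p n (2 * p ^ r)) := by
  have key : ∑ b ∈ Finset.range (n + 1), (n.choose b : ℚ) * sigmaSum p n b (2 * p ^ r) =
      Zsum p n (1 * p ^ r) := by
    have h := congrArg (PowerSeries.coeff (2 * p ^ r)) (congrArg (· ^ n) (fser_add p hodd))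
    simp only [← map_pow] at h
    rw [PowerSeries.coeff_expand, if_pos ⟨_, rfl⟩, Nat.mul_div_cancel_left _ two_pos, add_pow,
      map_sum] at h
    rw [one_mul, Z_eq_coeff, ← h]
    refine Finset.sum_congr rfl fun b hb => ?_
    rw [sigma_eq_coeff _ _ _ _ (by simpa [Nat.lt_succ_iff] using hb)]
    rw [← map_natCast (PowerSeries.C (R := ℚ)), PowerSeries.coeff_mul_C, mul_comm]
  set T : ℕ → ℚ := fun b => (n.choose b : ℚ) * sigmaSum p n b (2 * p ^ r) with hT
  have hsym : ∀ b ≤ n, T (n - b) = T b := by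
    intro b hb
    simp only [hT, Nat.choose_symm hb, sigma_symm p n b _ hb (even_two_mul _)]
  have hT0 : T 0 = Zsum p n (2 * p ^ r) := by simp [hT, Z_eq_sigma]
  rw [← hT0, ← key]
  have hL : ∑ b ∈ Finset.Icc 1 (n / 2),
        (if 2 ∣ n ∧ b = n / 2 then (2 : ℚ)⁻¹ else 1) * (n.choose b : ℚ) *
          sigmaSum p n b (2 * p ^ r) = ∑ b ∈ Finset.Icc 1 (n / 2),
        (if 2 ∣ n ∧ b = n / 2 then (2 : ℚ)⁻¹ else 1) * T b :=
    Finset.sum_congr rfl fun b _ => by simp only [hT]; ring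
  rw [hL]
  change _ = (2 : ℚ)⁻¹ * (∑ b ∈ Finset.range (n + 1), T b) - T 0
  clear_value T
  clear hL key hT hT0
  have hI : ∀ m, ∑ b ∈ Finset.Icc 1 m, T b = ∑ b ∈ Finset.range (m + 1), T b - T 0 := by
    intro m
    rw [Finset.sum_range_succ', add_sub_cancel_right, Finset.range_eq_Ico,
      Finset.sum_Ico_add' T 0 m 1]
    rfl
  rcases Nat.even_or_odd' n with ⟨k, rfl | rfl⟩
  · have hk : 2 * k / 2 = k := by omega
    rw [hk]
    obtain ⟨j, rfl⟩ : ∃ j, k = j + 1 := ⟨k - 1, by omega⟩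
    rw [Finset.sum_Icc_succ_top (by omega)]
    have : ∑ b ∈ Finset.Icc 1 j, (if 2 ∣ 2 * (j + 1) ∧ b = j + 1 then (2 : ℚ)⁻¹ else 1) * T b
        = ∑ b ∈ Finset.Icc 1 j, T b := by
      refine Finset.sum_congr rfl fun b hb => ?_
      rw [if_neg, one_mul]
      have := (Finset.mem_Icc.1 hb).2
      omega
    rw [this, hI, if_pos ⟨⟨_, rfl⟩, rfl⟩]
    have h2 : ∑ b ∈ Finset.range (2 * (j + 1) + 1), T b =
        2 * ∑ b ∈ Finset.range (j + 1), T b + T (j + 1) := by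
      rw [show 2 * (j + 1) + 1 = (j + 2) + (j + 1) by ring, Finset.sum_range_add,
        Finset.sum_range_succ _ (j + 1), ← Finset.sum_range_reflect _ (j + 1)]
      have : ∑ x ∈ Finset.range (j + 1), T (j + 2 + (x)) =
          ∑ x ∈ Finset.range (j + 1), T (j + 1 - 1 - x) := by
        refine Finset.sum_congr rfl fun x hx => ?_
        have := Finset.mem_range.1 hx
        rw [← hsym _ (by omega)]
        congr 1; omega
      rw [this]; ring
    rw [h2]; ring
  · have hk : (2 * k + 1) / 2 = k := by omega
    rw [hk]
    have : ∑ b ∈ Finset.Icc 1 k, (if 2 ∣ 2 * k + 1 ∧ b = k then (2 : ℚ)⁻¹ else 1) * T b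
        = ∑ b ∈ Finset.Icc 1 k, T b := by
      refine Finset.sum_congr rfl fun b hb => ?_
      rw [if_neg, one_mul]
      omega
    rw [this, hI]
    have h2 : ∑ b ∈ Finset.range (2 * k + 1 + 1), T b =
        2 * ∑ b ∈ Finset.range (k + 1), T b := by
      rw [show 2 * k + 1 + 1 = (k + 1) + (k + 1) by ring, Finset.sum_range_add,
        ← Finset.sum_range_reflect _ (k + 1)]
      have : ∑ x ∈ Finset.range (k + 1), T (k + 1 + (x)) =
          ∑ x ∈ Finset.range (k + 1), T (k + 1 - 1 - x) := by
        refine Finset.sum_congr rfl fun x hx => ?_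
        have := Finset.mem_range.1 hx
        rw [← hsym _ (by omega)]
        congr 1; omega
      rw [this]; ring
    rw [h2]; ring

section PS
open PowerSeries

/-- `1/(1-x)`. -/
noncomputable def Yser : PowerSeries ℚ := PowerSeries.mk 1

theorem Y_mul : Yser * (1 - X) = 1 := PowerSeries.mk_one_mul_one_sub_eq_one ℚ

theorem Y_eq : X * Yser + 1 = Yser := by
  have := Y_mul
  linear_combination -this

theorem dY : d⁄dX ℚ Yser = Yser ^ 2 := by
  have h := congrArg (d⁄dX ℚ) Y_mul
  rw [Derivation.leibniz] at h
  simp only [map_sub, derivative_X, derivative_one, smul_eq_mul] at h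
  have h2 := Y_mul
  linear_combination Yser * h - (d⁄dX ℚ Yser) * h2

theorem coeff_YZ (N i : ℕ) : coeff N (Yser * (X * Yser) ^ i) = (N.choose i : ℚ) := by
  have : Yser * (X * Yser) ^ i = X ^ i * Yser ^ (i + 1) := by ring
  rw [this, Yser, mk_one_pow_eq_mk_choose_add, coeff_X_pow_mul']
  split_ifs with h
  · simp [Nat.add_sub_cancel' h]
  · simp [Nat.choose_eq_zero_of_lt (not_le.1 h)]

/-- `1/(1-x^p)`. -/
noncomputable def Wser (p : ℕ) : PowerSeries ℚ := PowerSeries.mk fun l => if p ∣ l then 1 else 0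

theorem W_mul (p : ℕ) (hp : 0 < p) : Wser p * (1 - X ^ p) = 1 := by
  ext l
  rw [mul_sub, mul_one, map_sub, coeff_mul_X_pow', coeff_one]
  simp only [Wser, coeff_mk]
  by_cases h : p ≤ l
  · have h0 : l ≠ 0 := by omega
    simp [h, h0, Nat.dvd_sub_iff_left h dvd_rfl]
  · rw [if_neg h, sub_zero]
    by_cases h0 : l = 0
    · simp [h0]
    · rw [if_neg h0, if_neg]
      intro h1; exact h (Nat.le_of_dvd (by omega) h1)

theorem df (p : ℕ) (hp : 0 < p) : d⁄dX ℚ (fser p) = Yser - X ^ (p - 1) * Wser p := by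
  ext l
  rw [coeff_derivative, map_sub, coeff_X_pow_mul']
  simp only [fser, Yser, Wser, coeff_mk, Pi.one_apply]
  by_cases h : p ∣ l + 1
  · have := Nat.le_of_dvd (by omega) h
    rw [if_pos h, if_pos (by omega), if_pos]
    · simp
    · have : l - (p - 1) = l + 1 - p := by omega
      rw [this]; exact Nat.dvd_sub h dvd_rfl
  · rw [if_neg h]
    have h1 : (l : ℚ) + 1 ≠ 0 := by positivity
    push_cast
    rw [inv_mul_cancel₀ h1]
    split_ifs with h2 h3
    · exfalso; apply h
      have : l + 1 = (l - (p - 1)) + p := by omega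
      rw [this]; exact Dvd.dvd.add h3 dvd_rfl
    · simp
    · simp

/-- The key differential equation. -/
theorem key_diff (p : ℕ) (hp : 0 < p) (g : PowerSeries ℚ)
    (hg : (p : PowerSeries ℚ) * g + 1 = Yser ^ p - (X * Yser) ^ p) :
    (1 + (p : PowerSeries ℚ) * g) * d⁄dX ℚ (fser p) = d⁄dX ℚ g := by
  have hp0 : (p : PowerSeries ℚ) ≠ 0 := by
    rw [← map_natCast (C (R := ℚ)), Ne, map_eq_zero_iff _ C_injective]
    exact_mod_cast hp.ne'
  apply mul_left_cancel₀ hp0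
  have hu : (1 + (p : PowerSeries ℚ) * g) = Yser ^ p * (1 - X ^ p) := by
    rw [add_comm, hg]; ring
  have h := congrArg (d⁄dX ℚ) hu
  rw [map_add, Derivation.leibniz, Derivation.leibniz, derivative_pow, map_sub, derivative_pow,
    dY] at h
  simp only [derivative_one, derivative_X, smul_eq_mul, Derivation.map_natCast, mul_zero,
    zero_add, add_zero, mul_one, zero_sub] at h
  rw [hu, df p hp, h]
  obtain ⟨q, rfl⟩ : ∃ q, p = q + 1 := ⟨p - 1, by omega⟩
  have hW := W_mul (q + 1) (by omega)
  simp only [Nat.add_sub_cancel]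
  linear_combination (-((q + 1 : ℕ) : PowerSeries ℚ) * Yser ^ (q + 1) * X ^ q) * hW

theorem X_pow_dvd_of_deriv (F : PowerSeries ℚ) (T : ℕ) (h0 : constantCoeff F = 0)
    (h : X ^ T ∣ d⁄dX ℚ F) : X ^ (T + 1) ∣ F := by
  rw [X_pow_dvd_iff] at h ⊢
  intro m hm
  rcases m with _ | m
  · simpa using h0
  · have := h m (by omega)
    rw [coeff_derivative] at this
    have h1 : (m : ℚ) + 1 ≠ 0 := by positivity
    exact (mul_eq_zero.1 this).resolve_right h1

/-- The truncated logarithm. -/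
noncomputable def logPoly (p T : ℕ) : Polynomial ℚ :=
  ∑ j ∈ Finset.range T, Polynomial.monomial (j + 1) ((-(p : ℚ)) ^ j / ((j + 1 : ℕ) : ℚ))

theorem log_approx (p : ℕ) (hp : 0 < p) (g : PowerSeries ℚ) (h0 : constantCoeff g = 0)
    (hg : (p : PowerSeries ℚ) * g + 1 = Yser ^ p - (X * Yser) ^ p) (T : ℕ) :
    X ^ (T + 1) ∣ fser p - Polynomial.aeval g (logPoly p T) := by
  have hX : X ∣ g := X_dvd_iff.2 h0
  have hae : Polynomial.aeval g (logPoly p T) =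
      ∑ j ∈ Finset.range T, C ((-(p : ℚ)) ^ j / ((j + 1 : ℕ) : ℚ)) * g ^ (j + 1) := by
    simp [logPoly, Polynomial.aeval_monomial]
  apply X_pow_dvd_of_deriv
  · rw [hae, map_sub, map_sum]
    simp [fser, h0]
  · have hd : d⁄dX ℚ (Polynomial.aeval g (logPoly p T)) =
        (∑ j ∈ Finset.range T, (-(p : PowerSeries ℚ) * g) ^ j) * d⁄dX ℚ g := by
      rw [hae, map_sum, Finset.sum_mul]
      refine Finset.sum_congr rfl fun j _ => ?_
      rw [Derivation.leibniz, derivative_C, derivative_pow]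
      simp only [smul_eq_mul, mul_zero, add_zero, Nat.add_sub_cancel]
      have : C ((-(p : ℚ)) ^ j / ((j + 1 : ℕ) : ℚ)) * ((j + 1 : ℕ) : PowerSeries ℚ) =
          (-(p : PowerSeries ℚ)) ^ j := by
        rw [← map_natCast (C (R := ℚ)) (j + 1), ← map_mul, div_mul_cancel₀ _ (by positivity)]
        simp
      rw [mul_pow]
      linear_combination (g ^ j * d⁄dX ℚ g) * this
    have hk := key_diff p hp g hg
    have hgeo := mul_neg_geom_sum (-(p : PowerSeries ℚ) * g) T
    have hmain : (1 + (p : PowerSeries ℚ) * g) *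
        d⁄dX ℚ (fser p - Polynomial.aeval g (logPoly p T)) =
        (-(p : PowerSeries ℚ) * g) ^ T * d⁄dX ℚ g := by
      rw [map_sub, hd]
      linear_combination hk - d⁄dX ℚ g * hgeo
    have hu : IsUnit (1 + (p : PowerSeries ℚ) * g) := by
      rw [isUnit_iff_constantCoeff]; simp [h0]
    rw [← hu.dvd_mul_left, hmain]
    exact Dvd.dvd.mul_right (pow_dvd_pow_of_dvd (hX.mul_left _) T) _

theorem Z_eq_aeval (p : ℕ) (hp : 0 < p) (g : PowerSeries ℚ) (h0 : constantCoeff g = 0)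
    (hg : (p : PowerSeries ℚ) * g + 1 = Yser ^ p - (X * Yser) ^ p) (T n N : ℕ) (hN : N ≤ T) :
    Zsum p n N = coeff N (Polynomial.aeval g (logPoly p T ^ n)) := by
  rw [Z_eq_coeff, map_pow (Polynomial.aeval g), ← sub_eq_zero, ← map_sub]
  have := (log_approx p hp g h0 hg T).trans (sub_dvd_pow_sub_pow _ _ n)
  exact X_pow_dvd_iff.1 this N (by omega)

end PS

section Adic

theorem exists_g0 (p : ℕ) (hp : p.Prime) (hodd : Odd p) :
    ∃ g0 : Polynomial ℤ, (p : Polynomial ℤ) * g0 + 1 = (Polynomial.X + 1) ^ p - Polynomial.X ^ p ∧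
      Polynomial.X ∣ g0 ∧ (Polynomial.X + 1) ∣ g0 ∧ g0.natDegree ≤ p - 1 := by
  obtain ⟨s, hs⟩ := exists_add_pow_prime_eq hp (Polynomial.X : Polynomial ℤ) 1
  have hp0 : (p : ℤ) ≠ 0 := by exact_mod_cast hp.ne_zero
  have h1 : (p : Polynomial ℤ) * (Polynomial.X * s) + 1 =
      (Polynomial.X + 1) ^ p - Polynomial.X ^ p := by
    rw [hs]; ring
  refine ⟨Polynomial.X * s, h1, dvd_mul_right _ _, ?_, ?_⟩
  · have h2 := congrArg (Polynomial.eval (-1)) h1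
    rw [show (Polynomial.X + 1 : Polynomial ℤ) = Polynomial.X - Polynomial.C (-1) by simp,
      Polynomial.dvd_iff_isRoot, Polynomial.IsRoot]
    simp only [Polynomial.eval_add, Polynomial.eval_sub, Polynomial.eval_pow, Polynomial.eval_mul,
      Polynomial.eval_X, Polynomial.eval_one, Polynomial.eval_natCast, hodd.neg_one_pow] at h2 ⊢
    rw [neg_add_cancel, zero_pow hp.ne_zero] at h2
    have h3 : (p : ℤ) * (-1 * Polynomial.eval (-1) s) = 0 := by linarith
    exact (mul_eq_zero.1 h3).resolve_left hp0
  · rw [Polynomial.natDegree_le_iff_coeff_eq_zero]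
    intro k hk
    have hk' : p ≤ k := by have := hp.pos; omega
    have h2 := congrArg (fun q => Polynomial.coeff q k) h1
    simp only [Polynomial.coeff_add, Polynomial.coeff_sub, Polynomial.coeff_X_pow,
      Polynomial.coeff_X_add_one_pow, Polynomial.coeff_one] at h2
    rw [← map_natCast (Polynomial.C : ℤ →+* Polynomial ℤ) p, Polynomial.coeff_C_mul,
      if_neg (by have := hp.pos; omega)] at h2
    have h3 : (p : ℤ) * (Polynomial.X * s).coeff k = 0 := by
      rcases hk'.eq_or_lt with h | h
      · subst h; simp at h2; simpa using h2
      · rw [if_neg (by omega), Nat.choose_eq_zero_of_lt h] at h2; simpa using h2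
    exact (mul_eq_zero.1 h3).resolve_left hp0

theorem exists_Q (p : ℕ) (g0 : Polynomial ℤ) (hX : Polynomial.X ∣ g0)
    (hX1 : (Polynomial.X + 1) ∣ g0) (hd : g0.natDegree ≤ p - 1) (J : ℕ) :
    ∃ Q : Polynomial ℤ, Q.coeff 0 = 0 ∧ ∀ N, 0 < N →
      PowerSeries.coeff N ((Polynomial.aeval (PowerSeries.X * Yser) g0) ^ J) =
        ∑ i ∈ Finset.range ((p - 1) * J), (Q.coeff i : ℚ) * (N.choose i : ℚ) := by
  rcases Nat.eq_zero_or_pos J with rfl | hJ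
  · refine ⟨0, by simp, fun N hN => ?_⟩
    simp [PowerSeries.coeff_one, hN.ne']
  obtain ⟨Q, hQ⟩ := hX1.trans (dvd_pow_self g0 hJ.ne')
  have hQ0 : Q.coeff 0 = 0 := by
    obtain ⟨t, ht⟩ := hX.trans (dvd_pow_self g0 hJ.ne')
    have := congrArg (fun q => Polynomial.eval 0 q) (hQ.symm.trans ht)
    simpa [Polynomial.coeff_zero_eq_eval_zero] using this
  refine ⟨Q, hQ0, fun N _ => ?_⟩
  have hdeg : Q = 0 ∨ Q.natDegree < (p - 1) * J := by
    by_cases h0 : Q = 0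
    · exact Or.inl h0
    right
    have hm : (Polynomial.X + 1 : Polynomial ℤ).Monic := by
      simpa using Polynomial.monic_X_add_C (1 : ℤ)
    have h1 := hm.natDegree_mul' h0
    have h2 : (Polynomial.X + 1 : Polynomial ℤ).natDegree = 1 := by
      simpa using Polynomial.natDegree_X_add_C (1 : ℤ)
    rw [← hQ, h2] at h1
    have h3 : (g0 ^ J).natDegree ≤ J * (p - 1) :=
      Polynomial.natDegree_pow_le.trans (Nat.mul_le_mul_left _ hd)
    rw [mul_comm]; omega
  have hz : ∀ i, (p - 1) * J ≤ i → Q.coeff i = 0 := by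
    intro i hi
    rcases hdeg with rfl | h
    · simp
    · exact Polynomial.coeff_eq_zero_of_natDegree_lt (by omega)
  have hQs : Q = ∑ i ∈ Finset.range ((p - 1) * J), Polynomial.monomial i (Q.coeff i) := by
    ext k
    simp only [Polynomial.finsetSum_coeff, Polynomial.coeff_monomial]
    rw [Finset.sum_ite_eq']
    split_ifs with h
    · rfl
    · exact hz k (by simpa using h)
  rw [← map_pow, hQ, map_mul]
  have : Polynomial.aeval (PowerSeries.X * Yser) (Polynomial.X + 1 : Polynomial ℤ) = Yser := by
    simp [Y_eq]
  rw [this]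
  conv_lhs => rw [hQs]
  rw [map_sum, Finset.mul_sum, map_sum]
  refine Finset.sum_congr rfl fun i _ => ?_
  rw [Polynomial.aeval_monomial, ← coeff_YZ, mul_left_comm]
  have : (algebraMap ℤ (PowerSeries ℚ)) (Q.coeff i) = PowerSeries.C (Q.coeff i : ℚ) := by
    simp
  rw [this, PowerSeries.coeff_C_mul]

theorem choose_mod (p M k : ℕ) (hp : p.Prime) (hM : 0 < M) (hk : k < p ^ 2) :
    (((p ^ 2 * M - 1).choose k : ℕ) : ZMod p) = (-1) ^ k := by
  have := Fact.mk hp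
  have hN : 0 < p ^ 2 * M := Nat.mul_pos (pow_pos hp.pos 2) hM
  obtain ⟨m, hm⟩ : ∃ m, p ^ 2 * M = m + 1 := ⟨p ^ 2 * M - 1, by omega⟩
  induction k with
  | zero => simp
  | succ k ih =>
    have ih := ih (by omega)
    rw [hm] at ih ⊢
    simp only [Nat.add_sub_cancel] at ih ⊢
    have h1 : (m + 1) * m.choose k = (m + 1).choose (k + 1) * (k + 1) :=
      Nat.add_one_mul_choose_eq m k
    have h2 : p ∣ (m + 1).choose (k + 1) := by
      by_contra h
      have hc : Nat.Coprime (p ^ 2) ((m + 1).choose (k + 1)) :=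
        Nat.Coprime.pow_left 2 ((Nat.Prime.coprime_iff_not_dvd hp).2 h)
      have h3 : p ^ 2 ∣ (m + 1).choose (k + 1) * (k + 1) := by
        rw [← h1, ← hm, mul_assoc]; exact dvd_mul_right _ _
      have := Nat.le_of_dvd (by omega) (hc.dvd_of_dvd_mul_left h3)
      omega
    have h4 : (((m + 1).choose (k + 1) : ℕ) : ZMod p) = 0 := (ZMod.natCast_eq_zero_iff _ _).2 h2
    rw [Nat.choose_succ_succ] at h4
    push_cast at h4
    rw [ih] at h4
    rw [pow_succ]
    linear_combination h4

theorem norm_nat (p i : ℕ) (hi : i ≠ 0) :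
    padicNorm p (i : ℚ) = ((p : ℚ) ^ (padicValNat p i))⁻¹ := by
  rw [padicNorm.eq_zpow_of_nonzero (by exact_mod_cast hi), padicValRat.of_nat, zpow_neg,
    zpow_natCast]

theorem three_pow_ge (v : ℕ) : 2 * v + 1 ≤ 3 ^ v := by
  induction v with
  | zero => simp
  | succ v ih => rw [pow_succ]; omega

theorem two_val_le (p j : ℕ) (hp3 : 3 ≤ p) : 2 * padicValNat p (j + 1) ≤ j := by
  have h1 : p ^ padicValNat p (j + 1) ≤ j + 1 := Nat.le_of_dvd (by omega) pow_padicValNat_dvd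
  have h2 := three_pow_ge (padicValNat p (j + 1))
  have h3 := Nat.pow_le_pow_left hp3 (padicValNat p (j + 1))
  omega

theorem norm_log_coeff (p j : ℕ) [Fact p.Prime] :
    padicNorm p ((-(p : ℚ)) ^ j / ((j + 1 : ℕ) : ℚ)) =
      ((p : ℚ) ^ j)⁻¹ * (p : ℚ) ^ (padicValNat p (j + 1)) := by
  rw [padicNorm.div, norm_nat p (j + 1) (by omega), div_inv_eq_mul]
  congr 1
  have : ((-(p : ℚ)) ^ j) = (((-(1 : ℤ)) ^ j : ℤ) : ℚ) * ((p ^ j : ℕ) : ℚ) := by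
    push_cast; rw [← mul_pow]; ring
  rw [this, padicNorm.mul, norm_nat p _ (pow_ne_zero _ (Nat.Prime.ne_zero Fact.out))]
  rw [padicValNat.prime_pow]
  rcases neg_one_pow_eq_or ℤ j with h | h <;> simp [h]

theorem coeff_logPoly (p T k : ℕ) :
    (logPoly p T).coeff k = 0 ∨
      ∃ j, k = j + 1 ∧ (logPoly p T).coeff k = (-(p : ℚ)) ^ j / ((j + 1 : ℕ) : ℚ) := by
  rcases k with _ | j
  · left; simp [logPoly, Polynomial.finsetSum_coeff, Polynomial.coeff_monomial]
  · by_cases h : j < T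
    · right
      refine ⟨j, rfl, ?_⟩
      simp [logPoly, Polynomial.finsetSum_coeff, Polynomial.coeff_monomial, h]
    · left
      simp [logPoly, Polynomial.finsetSum_coeff, Polynomial.coeff_monomial, h]

theorem logPoly_int (p T : ℕ) [Fact p.Prime] (hp3 : 3 ≤ p) (n k : ℕ) :
    padicNorm p ((logPoly p T ^ n).coeff k) ≤ 1 := by
  have hp1 : (1 : ℚ) ≤ p := by exact_mod_cast (by omega : 1 ≤ p)
  induction n generalizing k with
  | zero =>
    rw [pow_zero, Polynomial.coeff_one]; split_ifs <;> simp
  | succ n ih =>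
    rw [pow_succ, Polynomial.coeff_mul]
    refine padicNorm.sum_le' (fun x _ => ?_) zero_le_one
    rw [padicNorm.mul]
    refine mul_le_one₀ (ih _) (padicNorm.nonneg _) ?_
    rcases coeff_logPoly p T x.2 with h | ⟨j, _, h⟩
    · simp [h]
    · rw [h, norm_log_coeff, inv_mul_le_one₀ (by positivity)]
      exact pow_le_pow_right₀ hp1 (by have := two_val_le p j hp3; omega)

theorem logPoly_bound (p T : ℕ) [Fact p.Prime] (hp3 : 3 ≤ p) (n k e : ℕ)
    (he : n + 2 * e ≤ k + 1) :
    padicNorm p ((logPoly p T ^ n).coeff k) ≤ ((p : ℚ) ^ e)⁻¹ := by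
  have hp1 : (1 : ℚ) ≤ p := by exact_mod_cast (by omega : 1 ≤ p)
  induction n generalizing k e with
  | zero =>
    rw [pow_zero, Polynomial.coeff_one]
    split_ifs with h
    · have : e = 0 := by omega
      simp [this]
    · simp
  | succ n ih =>
    rw [pow_succ, Polynomial.coeff_mul]
    refine padicNorm.sum_le' (fun x hx => ?_) (by positivity)
    have hx := Finset.HasAntidiagonal.mem_antidiagonal.1 hx
    rw [padicNorm.mul]
    rcases coeff_logPoly p T x.2 with h | ⟨j, hj, h⟩
    · simp [h]
    rw [h, norm_log_coeff]
    have hv := two_val_le p j hp3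
    obtain ⟨d, hd⟩ : ∃ d, j = padicValNat p (j + 1) + d := ⟨j - padicValNat p (j + 1), by omega⟩
    have hc : ((p : ℚ) ^ j)⁻¹ * (p : ℚ) ^ (padicValNat p (j + 1)) = ((p : ℚ) ^ d)⁻¹ := by
      have : (p : ℚ) ^ j = (p : ℚ) ^ (padicValNat p (j + 1)) * (p : ℚ) ^ d := by
        rw [← pow_add, ← hd]
      rw [this]
      have : (p : ℚ) ≠ 0 := by positivity
      field_simp
    rw [hc]
    rcases le_total e d with hed | hed
    · calc _ ≤ 1 * ((p : ℚ) ^ d)⁻¹ := by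
            gcongr; exact logPoly_int p T hp3 n _
        _ ≤ _ := by
            rw [one_mul]
            gcongr
    · calc _ ≤ ((p : ℚ) ^ (e - d))⁻¹ * ((p : ℚ) ^ d)⁻¹ := by
            gcongr; exact ih x.1 (e - d) (by omega)
        _ = _ := by
            rw [← mul_inv, ← pow_add, Nat.sub_add_cancel hed]

theorem arith_bound (p n J i v : ℕ) (hn : n + 1 < p) (hp : 5 ≤ p) (hi2 : p ^ 2 ≤ i)
    (hv : p ^ v ≤ i) (hi : i < (p - 1) * J) : n + 2 * v ≤ J + 1 := by
  obtain ⟨q, rfl⟩ : ∃ q, p = q + 1 := ⟨p - 1, by omega⟩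
  simp only [Nat.add_sub_cancel] at hi
  have hJ : q + 3 ≤ J := by
    by_contra h
    have : q * J ≤ q * (q + 2) := Nat.mul_le_mul_left _ (by omega)
    nlinarith
  rcases Nat.lt_or_ge v 3 with h | h
  · omega
  · obtain ⟨w, rfl⟩ : ∃ w, v = w + 2 := ⟨v - 2, by omega⟩
    have h1 : 2 * w + 1 ≤ (q + 1) ^ w :=
      (three_pow_ge w).trans (Nat.pow_le_pow_left (by omega) w)
    have h2 : (q + 1) * (q + 1) ^ w < J := by
      by_contra hc
      push Not at hc
      have : (q + 1) ^ (w + 2) = (q + 1) * ((q + 1) * (q + 1) ^ w) := by ring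
      nlinarith
    nlinarith

theorem term_bound (p T n M J i : ℕ) [hF : Fact p.Prime] (hn : n + 1 < p) (hp : 5 ≤ p)
    (hM : 0 < M) (hi0 : 0 < i) (hi : i < (p - 1) * J) :
    padicNorm p ((logPoly p T ^ n).coeff J *
      (((p ^ 2 * M).choose i : ℚ) - M * ((p ^ 2).choose i : ℚ))) ≤ padicNorm p (p ^ 2 * M : ℕ) := by
  have hp0 : 0 < p := by omega
  have hp1 : (1 : ℚ) ≤ p := by exact_mod_cast (by omega : 1 ≤ p)
  obtain ⟨k, rfl⟩ : ∃ k, i = k + 1 := ⟨i - 1, by omega⟩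
  have hN : 0 < p ^ 2 * M := Nat.mul_pos (pow_pos hp0 2) hM
  have key : ∀ A : ℕ, 0 < A → ((k + 1 : ℕ) : ℚ) * (A.choose (k + 1) : ℚ) =
      A * ((A - 1).choose k : ℚ) := by
    intro A hA
    obtain ⟨m, rfl⟩ : ∃ m, A = m + 1 := ⟨A - 1, by omega⟩
    have := Nat.add_one_mul_choose_eq m k
    rw [mul_comm, Nat.add_sub_cancel]
    exact_mod_cast this.symm
  have k1 := key _ hN
  have k2 := key (p ^ 2) (pow_pos hp0 2)
  set D : ℚ := (((p ^ 2 * M).choose (k + 1) : ℚ) - M * ((p ^ 2).choose (k + 1) : ℚ)) with hD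
  set E : ℤ := ((p ^ 2 * M - 1).choose k : ℤ) - ((p ^ 2 - 1).choose k : ℤ) with hE
  set P := (logPoly p T ^ n).coeff J with hP
  have hDE : ((k + 1 : ℕ) : ℚ) * D = (p ^ 2 * M : ℕ) * (E : ℚ) := by
    rw [hD, hE]
    push_cast at k1 k2 ⊢
    linear_combination k1 - M * k2
  have hipos : 0 < padicNorm p ((k + 1 : ℕ) : ℚ) :=
    lt_of_le_of_ne (padicNorm.nonneg _) (padicNorm.nonzero (by positivity)).symm
  have hPE : padicNorm p P * padicNorm p (E : ℚ) ≤ padicNorm p ((k + 1 : ℕ) : ℚ) := by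
    rw [norm_nat p _ (by omega)]
    have hdvd : p ^ padicValNat p (k + 1) ∣ k + 1 := pow_padicValNat_dvd
    have hle := Nat.le_of_dvd (by omega) hdvd
    rcases Nat.lt_or_ge (k + 1) (p ^ 2) with h | h
    · have hE1 : ((p ^ 1 : ℕ) : ℤ) ∣ E := by
        rw [pow_one, ← ZMod.intCast_zmod_eq_zero_iff_dvd, hE]
        have e1 := choose_mod p M k hF.out hM (by omega)
        have e2 := choose_mod p 1 k hF.out one_pos (by omega)
        rw [mul_one] at e2
        push_cast
        rw [e1, e2, sub_self]
      rw [padicNorm.dvd_iff_norm_le] at hE1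
      have hv : padicValNat p (k + 1) ≤ 1 := by
        by_contra hc
        push Not at hc
        have := Nat.pow_le_pow_right hp0 hc
        simp only [Nat.succ_eq_add_one] at this
        norm_num at this
        omega
      calc _ ≤ 1 * (p : ℚ) ^ (-(1 : ℕ) : ℤ) := by
            gcongr
            · exact padicNorm.nonneg _
            · exact logPoly_int p T (by omega) n J
        _ = ((p : ℚ) ^ 1)⁻¹ := by rw [one_mul, zpow_neg, zpow_natCast]
        _ ≤ _ := by gcongr
    · calc _ ≤ ((p : ℚ) ^ padicValNat p (k + 1))⁻¹ * 1 := by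
            gcongr
            · exact padicNorm.nonneg _
            · exact logPoly_bound p T (by omega) n J _ (arith_bound p n J _ _ hn hp h hle hi)
            · exact padicNorm.of_int _
        _ = _ := mul_one _
  have h3 := congrArg (padicNorm p) hDE
  rw [padicNorm.mul, padicNorm.mul] at h3
  rw [padicNorm.mul]
  refine le_of_mul_le_mul_left ?_ hipos
  calc _ = padicNorm p P * (padicNorm p ((k + 1 : ℕ) : ℚ) * padicNorm p D) := by ring
    _ = padicNorm p (p ^ 2 * M : ℕ) * (padicNorm p P * padicNorm p (E : ℚ)) := by rw [h3]; ring
    _ ≤ padicNorm p (p ^ 2 * M : ℕ) * padicNorm p ((k + 1 : ℕ) : ℚ) :=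
        mul_le_mul_of_nonneg_left hPE (padicNorm.nonneg _)
    _ = _ := by ring

theorem main_cong (p n M : ℕ) (hp : p.Prime) (hodd : Odd p) (hn : n + 1 < p) (hp5 : 5 ≤ p)
    (hM : 0 < M) :
    padicNorm p (Zsum p n (p ^ 2 * M) - M * Zsum p n (p ^ 2)) ≤ padicNorm p (p ^ 2 * M : ℕ) := by
  have := Fact.mk hp
  obtain ⟨g0, h1, hX, hX1, hd⟩ := exists_g0 p hp hodd
  set g := Polynomial.aeval (PowerSeries.X * Yser) g0 with hg
  have hc : PowerSeries.constantCoeff g = 0 := by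
    obtain ⟨t, rfl⟩ := hX
    simp [hg]
  have hgu : (p : PowerSeries ℚ) * g + 1 = Yser ^ p - (PowerSeries.X * Yser) ^ p := by
    have := congrArg (Polynomial.aeval (PowerSeries.X * Yser)) h1
    simpa [Y_eq] using this
  have hp2 : 0 < p ^ 2 := pow_pos hp.pos 2
  have hN : 0 < p ^ 2 * M := Nat.mul_pos hp2 hM
  set T := p ^ 2 * M with hT
  rw [Z_eq_aeval p hp.pos g hc hgu T n T le_rfl,
    Z_eq_aeval p hp.pos g hc hgu T n (p ^ 2) (Nat.le_mul_of_pos_right _ hM)]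
  have hexp : ∀ N, PowerSeries.coeff N (Polynomial.aeval g (logPoly p T ^ n)) =
      ∑ J ∈ Finset.range ((logPoly p T ^ n).natDegree + 1),
        (logPoly p T ^ n).coeff J * PowerSeries.coeff N (g ^ J) := by
    intro N
    rw [Polynomial.aeval_eq_sum_range, map_sum]
    simp
  rw [hexp, hexp, Finset.mul_sum, ← Finset.sum_sub_distrib]
  refine padicNorm.sum_le' (fun J _ => ?_) (padicNorm.nonneg _)
  obtain ⟨Q, hQ0, hQ⟩ := exists_Q p g0 hX hX1 hd J
  rw [hQ _ hN, hQ _ hp2, mul_left_comm, ← mul_sub, Finset.mul_sum, ← Finset.sum_sub_distrib,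
    Finset.mul_sum]
  refine padicNorm.sum_le' (fun i hi => ?_) (padicNorm.nonneg _)
  rcases Nat.eq_zero_or_pos i with rfl | hi0
  · simp [hQ0, padicNorm.nonneg]
  · have ht := term_bound p T n M J i hn hp5 hM hi0 (Finset.mem_range.1 hi)
    have : (logPoly p T ^ n).coeff J * ((Q.coeff i : ℚ) * (T.choose i : ℚ) -
        M * ((Q.coeff i : ℚ) * ((p ^ 2).choose i : ℚ))) =
        (Q.coeff i : ℚ) * ((logPoly p T ^ n).coeff J *
      (((p ^ 2 * M).choose i : ℚ) - M * ((p ^ 2).choose i : ℚ))) := by ring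
    rw [this, padicNorm.mul]
    calc _ ≤ 1 * padicNorm p (p ^ 2 * M : ℕ) := by
          gcongr
          · exact padicNorm.nonneg _
          · exact padicNorm.of_int _
      _ = _ := one_mul _

theorem S_eq_Z (p n : ℕ) (hn : 2 ≤ n) : Ssum p n 1 2 = Zsum p n (p ^ 2) := by
  rw [Ssum, Zsum, one_mul]
  refine Finset.sum_congr ?_ fun _ _ => rfl
  ext l
  simp only [Finset.mem_filter, Finset.Nat.mem_antidiagonalTuple]
  refine and_congr_right fun hs => ⟨fun h i => (h i).1, fun h i => ⟨h i, ?_⟩⟩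
  have : Nontrivial (Fin n) := Fin.nontrivial_iff_two_le.2 hn
  obtain ⟨j, hj⟩ := exists_ne i
  rw [← hs]
  exact Finset.single_lt_sum hj (Finset.mem_univ i) (Finset.mem_univ j) (h j).1
    (fun _ _ _ => Nat.zero_le _)

theorem part_two (n r : ℕ) (hn : 2 ≤ n) (p : ℕ) (hp : p.Prime) (hodd : Odd p)
    (hnp : n + 1 < p) (hr : 2 ≤ r) :
    padicCong p r ((2 : ℚ)⁻¹ * Zsum p n (1 * p ^ r) - Zsum p n (2 * p ^ r))
        (-(3 / 2 : ℚ) * Ssum p n 1 2 * (p : ℚ) ^ (r - 2)) := by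
  have := Fact.mk hp
  have hp5 : 5 ≤ p := by
    obtain ⟨k, rfl⟩ := hodd
    omega
  have hp1 : (1 : ℚ) < p := by exact_mod_cast (by omega : 1 < p)
  have hn2 : padicNorm p (2 : ℚ) = 1 := by
    have : ¬ p ∣ 2 := fun h => by have := Nat.le_of_dvd two_pos h; omega
    exact_mod_cast (padicNorm.nat_eq_one_iff (p := p) 2).2 this
  rw [S_eq_Z p n hn]
  obtain ⟨s, rfl⟩ : ∃ s, r = s + 2 := ⟨r - 2, by omega⟩
  have c1 := main_cong p n (p ^ s) hp hodd hnp hp5 (pow_pos hp.pos _)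
  have c2 := main_cong p n (2 * p ^ s) hp hodd hnp hp5 (by have := pow_pos hp.pos s; omega)
  have e1 : p ^ 2 * p ^ s = p ^ (s + 2) := by ring
  have e2 : p ^ 2 * (2 * p ^ s) = 2 * p ^ (s + 2) := by ring
  have hpn : padicNorm p ((p ^ (s + 2) : ℕ) : ℚ) = ((p : ℚ) ^ (s + 2))⁻¹ := by
    rw [norm_nat p _ (pow_ne_zero _ hp.ne_zero), padicValNat.prime_pow]
  rw [e1, hpn] at c1
  rw [e2] at c2
  have : ((2 * p ^ (s + 2) : ℕ) : ℚ) = 2 * ((p ^ (s + 2) : ℕ) : ℚ) := by push_cast; ring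
  rw [this, padicNorm.mul, hn2, one_mul, hpn] at c2
  rw [one_mul, Nat.add_sub_cancel]
  unfold padicCong
  by_cases hxy : (2 : ℚ)⁻¹ * Zsum p n (p ^ (s + 2)) - Zsum p n (2 * p ^ (s + 2)) =
      -(3 / 2 : ℚ) * Zsum p n (p ^ 2) * (p : ℚ) ^ s
  · exact Or.inl hxy
  right
  have hne := sub_ne_zero.2 hxy
  have hle : padicNorm p ((2 : ℚ)⁻¹ * Zsum p n (p ^ (s + 2)) - Zsum p n (2 * p ^ (s + 2)) -
      -(3 / 2 : ℚ) * Zsum p n (p ^ 2) * (p : ℚ) ^ s) ≤ ((p : ℚ) ^ (s + 2))⁻¹ := by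
    have : (2 : ℚ)⁻¹ * Zsum p n (p ^ (s + 2)) - Zsum p n (2 * p ^ (s + 2)) -
      -(3 / 2 : ℚ) * Zsum p n (p ^ 2) * (p : ℚ) ^ s =
      (Zsum p n (p ^ (s + 2)) - (p ^ s : ℕ) * Zsum p n (p ^ 2)) / 2 -
      (Zsum p n (2 * p ^ (s + 2)) - (2 * p ^ s : ℕ) * Zsum p n (p ^ 2)) := by
      push_cast; ring
    rw [this]
    refine padicNorm.sub.trans (max_le ?_ c2)
    rw [padicNorm.div, hn2, div_one]
    exact c1
  rw [padicNorm.eq_zpow_of_nonzero hne, ← zpow_natCast (p : ℚ) (s + 2), ← zpow_neg,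
    zpow_le_zpow_iff_right₀ hp1] at hle
  omega

end Adic

theorem stmt11 (n r : ℕ) (hn : 2 ≤ n) (hr : 1 ≤ r) (p : ℕ) (hp : p.Prime) (hodd : Odd p) :
    (∑ b ∈ Finset.Icc 1 (n / 2),
        (if 2 ∣ n ∧ b = n / 2 then (2 : ℚ)⁻¹ else 1) * (n.choose b : ℚ) *
          sigmaSum p n b (2 * p ^ r) =
      (2 : ℚ)⁻¹ * Zsum p n (1 * p ^ r) - Zsum p n (2 * p ^ r)) ∧
    (n + 1 < p → 2 ≤ r →
      padicCong p r
        (∑ b ∈ Finset.Icc 1 (n / 2),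
          (if 2 ∣ n ∧ b = n / 2 then (2 : ℚ)⁻¹ else 1) * (n.choose b : ℚ) *
            sigmaSum p n b (2 * p ^ r))
        (-(3 / 2 : ℚ) * Ssum p n 1 2 * (p : ℚ) ^ (r - 2))) := by

  have h1 := part_one n r hn p hodd
  refine ⟨h1, fun hnp h2 => ?_⟩
  rw [h1]
  exact part_two n r hn p hp hodd hnp h2
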